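/- arXiv:1307.6233 — 2 statements merged into one kernel-verified Lean document; each statement's English description precedes it below -/
import Mathlib

section
/- Let A and B be horizontal strips with |A| = |B|. If rows(A) ⊴ rows(B) in dominance order, then s_A − s_B is F-positive, i.e., for every composition α the number of standard Young tableaux of shape B with descent composition α is at most the number of standard Young tableaux of shape A with descent composition α; in particular Fsupp(A) ⊇ Fsupp(B). -/
namespace SkewPaper

open Finset

/-- A skew shape `λ/μ`, given by Young diagrams `μ ≤ λ`. -/
structure SkewShape where
  lam : YoungDiagram
  mu : YoungDiagram
  sub : mu ≤ lam

namespace SkewShape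

/-- The cells (boxes) of the skew shape `λ/μ`. -/
def cells (A : SkewShape) : Finset (ℕ × ℕ) :=
  A.lam.cells \ A.mu.cells

/-- The number of boxes of `A`. -/
def size (A : SkewShape) : ℕ := A.cells.card

end SkewShape

/-- The set of columns occupied by row `i` of the cell set `s`. -/
def rowCols (s : Finset (ℕ × ℕ)) (i : ℕ) : Finset ℕ :=
  (s.filter (fun c => c.1 = i)).image Prod.snd

/-- The set of rows occupied by column `j` of the cell set `s`. -/
def colRows (s : Finset (ℕ × ℕ)) (j : ℕ) : Finset ℕ :=
  (s.filter (fun c => c.2 = j)).image Prod.fst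

/-- `overlapRow s k i` : the number of columns occupied in common by
rows `i, i+1, …, i+k-1` of `s`. -/
def overlapRow (s : Finset (ℕ × ℕ)) (k i : ℕ) : ℕ :=
  ((rowCols s i).filter (fun j => ∀ t, t < k → j ∈ rowCols s (i + t))).card

/-- `overlapCol s l j` : the number of rows occupied in common by
columns `j, j+1, …, j+l-1` of `s`. -/
def overlapCol (s : Finset (ℕ × ℕ)) (l j : ℕ) : ℕ :=
  ((colRows s j).filter (fun i => ∀ t, t < l → i ∈ colRows s (j + t))).card

/-- `rows_k`: the partition (as the multiset of its nonzero parts) of overlaps of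
`k` consecutive rows. -/
def rowsk (s : Finset (ℕ × ℕ)) (k : ℕ) : Multiset ℕ :=
  ((s.image Prod.fst).val.map (overlapRow s k)).filter (fun m => 0 < m)

/-- `cols_l`: the partition (as the multiset of its nonzero parts) of overlaps of
`l` consecutive columns. -/
def colsk (s : Finset (ℕ × ℕ)) (l : ℕ) : Multiset ℕ :=
  ((s.image Prod.snd).val.map (overlapCol s l)).filter (fun m => 0 < m)

/-- `rects s k l`: the number of `k × l` rectangles of boxes contained inside `s`. -/
def rects (s : Finset (ℕ × ℕ)) (k l : ℕ) : ℕ :=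
  (s.filter (fun c => ∀ a, a < k → ∀ b, b < l → (c.1 + a, c.2 + b) ∈ s)).card

/-- The weakly decreasing sorted list of a multiset: the partition with those parts. -/
def sortDesc (s : Multiset ℕ) : List ℕ := (s.sort (· ≤ ·)).reverse

/-- Dominance order on partitions presented as multisets of parts:
every partial sum of the decreasing sort of `s` is at most the corresponding
partial sum for `t` (missing parts treated as `0`). -/
def Dom (s t : Multiset ℕ) : Prop :=
  ∀ j : ℕ, ((sortDesc s).take j).sum ≤ ((sortDesc t).take j).sum

/-- The conjugate (transpose) of a partition presented as a multiset of parts. -/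
def conjM (s : Multiset ℕ) : Multiset ℕ :=
  (Multiset.range s.sup).map (fun j => Multiset.card (s.filter (fun x => j < x)))

/-- A standard Young tableau of shape `A`: a bijective filling of the cells of `A`
by `1, …, |A|` which increases from left to right along rows and from top to
bottom down columns.  (Entries off the shape are normalized to `0`.) -/
structure SYT (A : SkewShape) where
  entry : ℕ × ℕ → ℕ
  zero_off : ∀ c, c ∉ A.cells → entry c = 0
  mem_range : ∀ c ∈ A.cells, entry c ∈ Finset.Icc 1 A.size
  injOn : Set.InjOn entry ↑A.cells
  row_lt : ∀ i j j', (i, j) ∈ A.cells → (i, j') ∈ A.cells → j < j' →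
    entry (i, j) < entry (i, j')
  col_lt : ∀ i i' j, (i, j) ∈ A.cells → (i', j) ∈ A.cells → i < i' →
    entry (i, j) < entry (i', j)

/-- The descent set of a standard Young tableau: those `k ∈ {1, …, n-1}` such that
`k+1` appears in a strictly lower row than `k`. -/
def SYT.descentSet {A : SkewShape} (T : SYT A) : Finset ℕ :=
  (Finset.Ico 1 A.size).filter (fun k =>
    ∃ c ∈ A.cells, ∃ c' ∈ A.cells, T.entry c = k ∧ T.entry c' = k + 1 ∧ c.1 < c'.1)

/-- The composition of `n` corresponding to a subset `D ⊆ {1, …, n-1}`: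
its partial sums are the elements of `D`. -/
def compOfSet (n : ℕ) (D : Finset ℕ) : List ℕ :=
  if n = 0 then []
  else
    let l := D.sort (· ≤ ·) ++ [n]
    List.zipWith (fun x y => x - y) l (0 :: l)

/-- The descent composition of a standard Young tableau. -/
def SYT.descentComp {A : SkewShape} (T : SYT A) : List ℕ :=
  compOfSet A.size T.descentSet

/-- The F-support of `A`: the set of descent compositions of SYT of shape `A`. -/
def Fsupp (A : SkewShape) : Set (List ℕ) :=
  {α | ∃ T : SYT A, T.descentComp = α}

/-- The number of standard Young tableaux of shape `A` with descent composition `α`. -/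
noncomputable def countSYT (A : SkewShape) (α : List ℕ) : ℕ :=
  Nat.card {T : SYT A // T.descentComp = α}

/-- `S(γ)`: the set of proper partial sums of the composition `γ`. -/
def Sset (γ : List ℕ) : Finset ℕ :=
  ((List.range (γ.length - 1)).map (fun j => (γ.take (j + 1)).sum)).toFinset

/-- `cols(α)` for a composition `α` of `n`, as a multiset: the parts of the
composition corresponding to the complement of `S(α)` in `{1, …, n-1}`. -/
def colsComp (α : List ℕ) : Multiset ℕ :=
  ↑(compOfSet α.sum ((Finset.Icc 1 (α.sum - 1)) \ Sset α))

/-- Delete the leftmost box of every nonempty row. -/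
def trimCells (s : Finset (ℕ × ℕ)) : Finset (ℕ × ℕ) :=
  s.filter (fun c => 1 ≤ c.2 ∧ (c.1, c.2 - 1) ∈ s)

/-- `s` is a ribbon whose (nonempty) rows are exactly rows `r0, …, r1`, with every
pair of adjacent rows overlapping in exactly one column. -/
def IsRibbonOn (s : Finset (ℕ × ℕ)) (r0 r1 : ℕ) : Prop :=
  r0 ≤ r1 ∧ (∀ i, (rowCols s i).Nonempty ↔ r0 ≤ i ∧ i ≤ r1) ∧
    (∀ i, r0 ≤ i → i < r1 → (rowCols s i ∩ rowCols s (i + 1)).card = 1)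

/-- `A` is a ribbon. -/
def SkewShape.IsRibbon (A : SkewShape) : Prop :=
  ∃ r0 r1, IsRibbonOn A.cells r0 r1

/-- An elongated ribbon: a ribbon all of whose rows have length at least two. -/
def ElongatedRibbon (A : SkewShape) : Prop :=
  A.IsRibbon ∧ ∀ i, (rowCols A.cells i).Nonempty → 2 ≤ (rowCols A.cells i).card

/-- A horizontal strip: at most one box in each column. -/
def IsHorizontalStrip (A : SkewShape) : Prop :=
  ∀ j, (colRows A.cells j).card ≤ 1

/-- `A` is F-multiplicity-free: distinct SYT of shape `A` have distinct descent sets. -/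
def FMultFree (A : SkewShape) : Prop :=
  ∀ T T' : SYT A, T.descentSet = T'.descentSet → T = T'

/-- The cells of a shape, viewed inside `ℤ × ℤ`. -/
def toZ (s : Finset (ℕ × ℕ)) : Finset (ℤ × ℤ) :=
  s.image (fun c => ((c.1 : ℤ), (c.2 : ℤ)))

/-- The cells of the hook `(m, 1^l)`. -/
def hookCells (m l : ℕ) : Finset (ℕ × ℕ) :=
  ((Finset.range m).image (fun j => ((0 : ℕ), j))) ∪
    ((Finset.Icc 1 l).image (fun i => (i, (0 : ℕ))))



/-- The ascent set of a word, with positions counted from `1`. -/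
def ascents {α : Type*} [LinearOrder α] {n : ℕ} (w : Fin n → α) : Finset ℕ :=
  (Finset.Ico 1 n).filter (fun k => ∃ i j : Fin n, (i : ℕ) + 1 = k ∧ (j : ℕ) = k ∧ w i < w j)

open Classical in
/-- The words of length `n` with content `c` whose ascent set satisfies `Φ`. -/
noncomputable def words {α : Type*} [LinearOrder α] [Fintype α] (n : ℕ) (Φ : Finset ℕ → Prop)
    (c : α → ℕ) : Finset (Fin n → α) :=
  Finset.univ.filter (fun w =>
    (∀ a, (Finset.univ.filter (fun i => w i = a)).card = c a) ∧ Φ (ascents w))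

theorem mem_words {α : Type*} [LinearOrder α] [Fintype α] {n : ℕ} {Φ : Finset ℕ → Prop}
    {c : α → ℕ} {w : Fin n → α} : w ∈ words n Φ c ↔
      (∀ a, (Finset.univ.filter (fun i => w i = a)).card = c a) ∧ Φ (ascents w) := by
  simp [words]

/-- `c'` is obtained from `c` by moving `r` units from `x` to `y`. -/
def Transfer {α : Type*} (x y : α) (r : ℕ) (c c' : α → ℕ) : Prop :=
  c x = c' x + r ∧ c' y = c y + r ∧ ∀ z, z ≠ x → z ≠ y → c' z = c z

/-- The number of `x` minus the number of `y` among the first `k` letters of `w`. -/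
def height {α : Type*} [DecidableEq α] {n : ℕ} (x y : α) (w : Fin n → α) (k : ℕ) : ℤ :=
  ∑ i : Fin n, if (i : ℕ) < k then
    (if w i = x then 1 else 0) - (if w i = y then 1 else 0) else 0

section height

variable {α : Type*} [DecidableEq α] {n : ℕ} {x y : α}

theorem height_zero (w : Fin n → α) : height x y w 0 = 0 := by
  simp [height]

theorem height_succ (w : Fin n → α) (j : Fin n) :
    height x y w (j + 1) =
      height x y w j + ((if w j = x then 1 else 0) - (if w j = y then 1 else 0)) := by
  have h : ∀ i : Fin n, (if (i : ℕ) < j + 1 then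
        ((if w i = x then (1 : ℤ) else 0) - (if w i = y then 1 else 0)) else 0)
      = (if (i : ℕ) < j then ((if w i = x then (1 : ℤ) else 0) - (if w i = y then 1 else 0)) else 0)
        + (if i = j then ((if w j = x then (1 : ℤ) else 0) - (if w j = y then 1 else 0)) else 0) := by
    intro i
    rcases lt_trichotomy i j with h | h | h
    · have h1 : (i : ℕ) < j := h
      simp [h1, h.ne, Nat.lt_succ_of_lt h1]
    · subst h
      simp
    · have h1 : (j : ℕ) < i := h
      simp [h.ne', not_lt.2 h1.le, show ¬ (i : ℕ) < j + 1 by omega]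
  simp only [height]
  rw [Finset.sum_congr rfl (fun i _ => h i), Finset.sum_add_distrib]
  simp

theorem height_full (w : Fin n → α) :
    height x y w n = ((Finset.univ.filter (fun i => w i = x)).card : ℤ) -
      (Finset.univ.filter (fun i => w i = y)).card := by
  simp [height, Finset.sum_sub_distrib]

theorem height_update (hxy : x ≠ y) (w : Fin n → α) (j : Fin n) (hj : w j = x) (k : ℕ) :
    height x y (Function.update w j y) k = height x y w k - (if (j : ℕ) < k then 2 else 0) := by
  have h : ∀ i : Fin n, (if (i : ℕ) < k then
        ((if Function.update w j y i = x then (1 : ℤ) else 0) -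
          (if Function.update w j y i = y then 1 else 0)) else 0)
      = (if (i : ℕ) < k then ((if w i = x then (1 : ℤ) else 0) - (if w i = y then 1 else 0)) else 0)
        - (if i = j then (if (j : ℕ) < k then 2 else 0) else 0) := by
    intro i
    by_cases h : i = j
    · subst h
      by_cases hk : (i : ℕ) < k <;> simp [hj, hk, hxy, hxy.symm]
    · simp [h]
  simp only [height]
  rw [Finset.sum_congr rfl (fun i _ => h i), Finset.sum_sub_distrib]
  simp

/-- `w'` arises from `w` by replacing with `y` the letter `x` at which the height of `w`
first attains its maximum. -/
def Lowers (x y : α) (w w' : Fin n → α) : Prop :=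
  ∃ j : Fin n, w j = x ∧ w' = Function.update w j y ∧
    (∀ k ≤ (j : ℕ), height x y w k < height x y w (j + 1)) ∧
    ∀ k, (j : ℕ) < k → k ≤ n → height x y w k ≤ height x y w (j + 1)

theorem Lowers.injective (hxy : x ≠ y) {w₁ w₂ w' : Fin n → α}
    (h₁ : Lowers x y w₁ w') (h₂ : Lowers x y w₂ w') : w₁ = w₂ := by
  have key : ∀ {w : Fin n → α} {j : Fin n}, w j = x → w' = Function.update w j y →
      (∀ k ≤ (j : ℕ), height x y w k < height x y w (j + 1)) →
      (∀ k, (j : ℕ) < k → k ≤ n → height x y w k ≤ height x y w (j + 1)) →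
      (∀ k ≤ (j : ℕ), height x y w' k ≤ height x y w' j) ∧
      (∀ k, (j : ℕ) < k → k ≤ n → height x y w' k < height x y w' j) := by
    intro w j hj hw' hle hgt
    have hs : height x y w (j + 1) = height x y w j + 1 := by
      rw [height_succ]; simp [hj, hxy]
    subst hw'
    constructor
    · intro k hk
      have := hle k hk
      rw [height_update hxy w j hj, height_update hxy w j hj]
      simp only [not_lt.2 hk, lt_irrefl, if_false]
      omega
    · intro k hk hkn
      have := hgt k hk hkn
      rw [height_update hxy w j hj, height_update hxy w j hj]
      simp only [hk, lt_irrefl, if_false, if_true]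
      omega
  obtain ⟨j₁, e₁, u₁, a₁, b₁⟩ := h₁
  obtain ⟨j₂, e₂, u₂, a₂, b₂⟩ := h₂
  obtain ⟨c₁, d₁⟩ := key e₁ u₁ a₁ b₁
  obtain ⟨c₂, d₂⟩ := key e₂ u₂ a₂ b₂
  have hj : j₁ = j₂ := by
    rcases lt_trichotomy j₁ j₂ with h | h | h
    · exact absurd (d₁ j₂ h j₂.2.le) (not_lt.2 (c₂ j₁ h.le))
    · exact h
    · exact absurd (d₂ j₁ h j₁.2.le) (not_lt.2 (c₁ j₂ h.le))
  subst hj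
  have r₁ : w₁ = Function.update w' j₁ x := by rw [u₁, ← e₁]; simp
  have r₂ : w₂ = Function.update w' j₁ x := by rw [u₂, ← e₂]; simp
  rw [r₁, r₂]

theorem exists_lowers {w : Fin n → α} {r : ℕ}
    (hr : ∃ k ≤ n, ((r + 1 : ℕ) : ℤ) ≤ height x y w k) (hxy : x ≠ y) :
    ∃ w', Lowers x y w w' ∧ ∃ k ≤ n, (r : ℤ) ≤ height x y w' k := by
  obtain ⟨k₀, hk₀, hrk⟩ := hr
  obtain ⟨K, hK, hmax⟩ := Finset.exists_max_image (Finset.range (n + 1)) (height x y w)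
    ⟨0, by simp⟩
  have hex : ∃ k, k ≤ n ∧ height x y w K ≤ height x y w k :=
    ⟨K, by simpa [Nat.lt_succ_iff] using hK, le_rfl⟩
  classical
  obtain ⟨hj, hle⟩ := Nat.find_spec hex
  have hmin := fun k => @Nat.find_min _ _ hex k
  have hbig : ∀ k ≤ n, height x y w k ≤ height x y w K := fun k hk =>
    hmax k (by simpa [Nat.lt_succ_iff] using hk)
  rcases hf : Nat.find hex with _ | j
  · rw [hf, height_zero] at hle
    have := hbig k₀ hk₀
    push_cast at hrk
    omega
  rw [hf] at hj hle hmin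
  let J : Fin n := ⟨j, hj⟩
  have hlt : ∀ k ≤ j, height x y w k < height x y w (j + 1) := fun k hk => by
    have h := hmin k (Nat.lt_succ_of_le hk)
    have : ¬ height x y w K ≤ height x y w k := fun h' => h ⟨by omega, h'⟩
    omega
  have hs := height_succ (x := x) (y := y) w J
  have hJ : w J = x := by
    by_contra hne
    have := hlt j le_rfl
    rw [if_neg hne] at hs
    split_ifs at hs <;> simp only [J] at hs <;> omega
  refine ⟨Function.update w J y, ⟨J, hJ, rfl, hlt, fun k _ hk => (hbig k hk).trans hle⟩,
    j, by omega, ?_⟩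
  rw [height_update hxy w J hJ]
  have := hbig k₀ hk₀
  simp only [hJ, hxy, if_true, if_false] at hs
  simp only [J, lt_irrefl, if_false] at hs ⊢
  push_cast at hrk
  omega

theorem Lowers.card_filter (hxy : x ≠ y) {w w' : Fin n → α} (h : Lowers x y w w') :
    Transfer x y 1 (fun a => (Finset.univ.filter (fun i => w i = a)).card)
      (fun a => (Finset.univ.filter (fun i => w' i = a)).card) := by
  obtain ⟨j, hj, rfl, -, -⟩ := h
  refine ⟨?_, ?_, ?_⟩
  · beta_reduce
    rw [show (Finset.univ.filter (fun i => Function.update w j y i = x)) =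
      (Finset.univ.filter (fun i => w i = x)).erase j by
        ext i; by_cases h : i = j
        · subst h; simp [hxy.symm]
        · simp [h]]
    exact (Finset.card_erase_add_one (by simp [hj])).symm
  · beta_reduce
    rw [show (Finset.univ.filter (fun i => Function.update w j y i = y)) =
      insert j (Finset.univ.filter (fun i => w i = y)) by
        ext i; by_cases h : i = j
        · subst h; simp
        · simp [h]]
    exact Finset.card_insert_of_notMem (by simp [hj, hxy])
  · intro z hzx hzy
    beta_reduce
    congr 1
    ext i
    by_cases h : i = j
    · subst h; simp [hj, hzx.symm, hzy.symm]
    · simp [h]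

end height

theorem Lowers.ascents_eq {α : Type*} [LinearOrder α] {n : ℕ} {x y : α} (hyx : y ⋖ x)
    {w w' : Fin n → α} (h : Lowers x y w w') : ascents w' = ascents w := by
  obtain ⟨j, hj, rfl, hlt, hgt⟩ := h
  have hne := hyx.lt.ne
  refine Finset.filter_congr fun k hk => ?_
  refine exists_congr fun a => exists_congr fun b => and_congr_right fun ha =>
    and_congr_right fun hb => ?_
  by_cases h1 : a = j
  · subst h1
    have h2 : b ≠ a := by rintro rfl; omega
    rw [Function.update_self, Function.update_of_ne h2, hj]
    have hbx : w b ≠ x := by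
      intro hbx
      have hs := height_succ (x := x) (y := y) w b
      rw [if_pos hbx, if_neg (by rw [hbx]; exact hne.symm)] at hs
      have := hgt (b + 1) (by omega) b.2
      rw [ha, ← hb] at this
      omega
    constructor
    · intro h
      exact lt_of_le_of_ne (not_lt.1 fun h' => hyx.2 h h') (Ne.symm hbx)
    · exact hyx.lt.trans
  · rw [Function.update_of_ne h1]
    by_cases h2 : b = j
    · subst h2
      rw [Function.update_self, hj]
      have hay : w a ≠ y := by
        intro hay
        have hs := height_succ (x := x) (y := y) w a
        rw [if_pos hay, if_neg (by rw [hay]; exact hne)] at hs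
        have hs' := height_succ (x := x) (y := y) w b
        rw [if_pos hj, if_neg (by rw [hj]; exact hne.symm)] at hs'
        have := hlt a (by omega)
        rw [ha, ← hb] at hs
        omega
      constructor
      · exact fun h => h.trans hyx.lt
      · intro h
        exact lt_of_le_of_ne (not_lt.1 fun h' => hyx.2 h' h) hay
    · rw [Function.update_of_ne h2]

section transfer

variable {α : Type*} [LinearOrder α] [Fintype α]

open Classical in
theorem card_words_height_le {x y : α} (hyx : y ⋖ x) (n : ℕ) (Φ : Finset ℕ → Prop) (r : ℕ) :
    ∀ {c c' : α → ℕ}, Transfer x y r c c' →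
      ((words n Φ c).filter (fun w => ∃ k ≤ n, (r : ℤ) ≤ height x y w k)).card ≤
        (words n Φ c').card := by
  have hne : x ≠ y := hyx.lt.ne'
  induction r with
  | zero =>
    intro c c' h
    have : c' = c := by
      ext z
      by_cases hx : z = x
      · subst hx; simpa using h.1.symm
      by_cases hy : z = y
      · subst hy; simpa using h.2.1
      exact h.2.2 z hx hy
    rw [this]
    exact Finset.card_filter_le _ _
  | succ r ih =>
    intro c c' h
    let c₁ : α → ℕ := Function.update (Function.update c x (c x - 1)) y (c y + 1)
    obtain ⟨h1, h2, h3⟩ := h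
    have hc₁x : c₁ x = c x - 1 := by simp [c₁, hne]
    have hc₁y : c₁ y = c y + 1 := by simp [c₁]
    have hc₁z : ∀ z, z ≠ x → z ≠ y → c₁ z = c z := fun z hx hy => by simp [c₁, hx, hy]
    have hT : Transfer x y r c₁ c' :=
      ⟨by omega, by omega, fun z hx hy => by rw [hc₁z z hx hy, h3 z hx hy]⟩
    refine le_trans ?_ (ih hT)
    have hex : ∀ w : Fin n → α, ∃ w', (∃ k ≤ n, ((r + 1 : ℕ) : ℤ) ≤ height x y w k) →
        Lowers x y w w' ∧ ∃ k ≤ n, (r : ℤ) ≤ height x y w' k := by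
      intro w
      by_cases hw : ∃ k ≤ n, ((r + 1 : ℕ) : ℤ) ≤ height x y w k
      · obtain ⟨w', h⟩ := exists_lowers hw hne
        exact ⟨w', fun _ => h⟩
      · exact ⟨w, fun h => absurd h hw⟩
    choose f hf using hex
    refine Finset.card_le_card_of_injOn f ?_ ?_
    · intro w hw
      simp only [Finset.coe_filter, Set.mem_ofPred_eq, words, Finset.mem_filter,
        Finset.mem_univ, true_and] at hw ⊢
      obtain ⟨⟨hcont, hΦ⟩, hk⟩ := hw
      obtain ⟨hL, hk'⟩ := hf w hk
      refine ⟨⟨fun a => ?_, by rwa [hL.ascents_eq hyx]⟩, hk'⟩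
      obtain ⟨t1, t2, t3⟩ := hL.card_filter hne
      by_cases hx : a = x
      · subst hx
        have := hcont a
        simp only at t1
        omega
      by_cases hy : a = y
      · subst hy
        have := hcont a
        simp only at t2
        omega
      rw [hc₁z a hx hy, ← hcont a]
      exact t3 a hx hy
    · intro w₁ hw₁ w₂ hw₂ he
      have l₁ := (hf w₁ (Finset.mem_filter.1 hw₁).2).1
      have l₂ := (hf w₂ (Finset.mem_filter.1 hw₂).2).1
      rw [← he] at l₂
      exact l₁.injective hne l₂

theorem card_words_le_of_covBy {x y : α} (hyx : y ⋖ x) (n : ℕ) (Φ : Finset ℕ → Prop) {r : ℕ}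
    {c c' : α → ℕ} (h : Transfer x y r c c') (hr : c y + r ≤ c x) :
    (words n Φ c).card ≤ (words n Φ c').card := by
  classical
  refine le_trans (le_of_eq ?_) (card_words_height_le hyx n Φ r h)
  rw [Finset.filter_true_of_mem]
  intro w hw
  simp only [words, Finset.mem_filter, Finset.mem_univ, true_and] at hw
  refine ⟨n, le_rfl, ?_⟩
  rw [height_full]
  have h1 := hw.1 x
  have h2 := hw.1 y
  simp only [Finset.card_filter] at h1 h2 ⊢
  omega

end transfer

theorem image_ascents_rev {α : Type*} [LinearOrder α] {n : ℕ} (w : Fin n → α) :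
    (ascents (fun i => OrderDual.toDual (w i.rev))).image (fun k => n - k) = ascents w := by
  ext k
  simp only [ascents, Finset.mem_image, Finset.mem_filter, Finset.mem_Ico]
  constructor
  · rintro ⟨l, ⟨hl, i, j, hi, hj, hlt⟩, rfl⟩
    refine ⟨by omega, j.rev, i.rev, ?_, ?_, hlt⟩ <;> rw [Fin.val_rev] <;> omega
  · rintro ⟨hk, i, j, hi, hj, hlt⟩
    refine ⟨n - k, ⟨by omega, j.rev, i.rev, ?_, ?_, ?_⟩, by omega⟩
    · rw [Fin.val_rev]; omega
    · rw [Fin.val_rev]; omega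
    · simpa using hlt

theorem card_words_dual {α : Type*} [LinearOrder α] [Fintype α] (n : ℕ) (Φ : Finset ℕ → Prop)
    (c : α → ℕ) : (words n Φ c).card =
      (words (α := αᵒᵈ) n (fun D => Φ (D.image (fun k => n - k)))
        (fun a => c (OrderDual.ofDual a))).card := by
  refine Finset.card_equiv (Equiv.arrowCongr Fin.revPerm OrderDual.toDual) fun w => ?_
  have he : Equiv.arrowCongr Fin.revPerm OrderDual.toDual w =
      fun i => OrderDual.toDual (w i.rev) := rfl
  rw [he]
  simp only [words, Finset.mem_filter, Finset.mem_univ, true_and, image_ascents_rev]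
  refine and_congr_left fun _ => ?_
  rw [OrderDual.forall]
  refine forall_congr' fun a => ?_
  rw [show (Finset.univ.filter fun i : Fin n => OrderDual.toDual (w i.rev) = OrderDual.toDual a) =
    (Finset.univ.filter fun i => w i = a).map Fin.revPerm.toEmbedding by
      ext i
      simp only [Finset.mem_map_equiv, Finset.mem_filter, Finset.mem_univ, true_and]
      rfl]
  rw [Finset.card_map, OrderDual.ofDual_toDual]

theorem card_words_le_of_covBy' {α : Type*} [LinearOrder α] [Fintype α] {x y : α} (hxy : x ⋖ y)
    (n : ℕ) (Φ : Finset ℕ → Prop) {r : ℕ} {c c' : α → ℕ} (h : Transfer x y r c c')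
    (hr : c y + r ≤ c x) : (words n Φ c).card ≤ (words n Φ c').card := by
  rw [card_words_dual n Φ c, card_words_dual n Φ c']
  exact card_words_le_of_covBy (x := OrderDual.toDual x) (y := OrderDual.toDual y) hxy.toDual n _
    ⟨h.1, h.2.1, fun z => h.2.2 (OrderDual.ofDual z)⟩ hr

theorem card_words_le_comp_perm {m : ℕ} (n : ℕ) (Φ : Finset ℕ → Prop) (c : Fin m → ℕ)
    (σ : Equiv.Perm (Fin m)) : (words n Φ c).card ≤ (words n Φ (c ∘ σ)).card := by
  rcases m with _ | m
  · rw [Subsingleton.elim (c ∘ σ) c]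
  have hσ : σ ∈ Submonoid.closure
      (Set.range fun i : Fin m ↦ Equiv.swap i.castSucc i.succ) := by
    rw [Equiv.Perm.mclosure_swap_castSucc_succ]; trivial
  induction hσ using Submonoid.closure_induction generalizing c with
  | one => exact le_rfl
  | mul σ τ _ _ hσ hτ => exact (hσ c).trans (hτ (c ∘ σ))
  | mem σ hσ =>
    obtain ⟨i, rfl⟩ := hσ
    have hcov : i.castSucc ⋖ i.succ := by
      refine ⟨Fin.castSucc_lt_succ, fun z h1 h2 => ?_⟩
      simp only [Fin.lt_def, Fin.val_castSucc, Fin.val_succ] at h1 h2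
      omega
    have hne := hcov.lt.ne
    rcases le_total (c i.succ) (c i.castSucc) with h | h
    · refine card_words_le_of_covBy' hcov n Φ (r := c i.castSucc - c i.succ) ⟨?_, ?_, ?_⟩
        (by omega)
      · simp; omega
      · simp; omega
      · intro z hz hz'
        simp [Equiv.swap_apply_of_ne_of_ne hz hz']
    · refine card_words_le_of_covBy hcov n Φ (r := c i.succ - c i.castSucc) ⟨?_, ?_, ?_⟩
        (by omega)
      · simp; omega
      · simp; omega
      · intro z hz hz'
        simp [Equiv.swap_apply_of_ne_of_ne hz' hz]

theorem card_words_le_of_transfer {m : ℕ} (n : ℕ) (Φ : Finset ℕ → Prop) {i j : Fin m}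
    (hij : i ≠ j) {r : ℕ} {c c' : Fin m → ℕ} (h : Transfer i j r c c') (hr : c j + r ≤ c i) :
    (words n Φ c).card ≤ (words n Φ c').card := by
  rcases m with _ | _ | m
  · exact i.elim0
  · exact absurd (Fin.ext (by omega)) hij
  have h01 : (0 : Fin (m + 2)) ≠ 1 := by simp
  obtain ⟨σ, h0, h1⟩ : ∃ σ : Equiv.Perm (Fin (m + 2)), σ 0 = i ∧ σ 1 = j := by
    have hj : Equiv.swap 0 i j ≠ 0 := by
      intro h
      rw [Equiv.swap_apply_eq_iff, Equiv.swap_apply_left] at h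
      exact hij h.symm
    refine ⟨Equiv.swap 0 i * Equiv.swap 1 (Equiv.swap 0 i j), ?_, ?_⟩
    · rw [Equiv.Perm.mul_apply, Equiv.swap_apply_of_ne_of_ne h01 hj.symm, Equiv.swap_apply_left]
    · rw [Equiv.Perm.mul_apply, Equiv.swap_apply_left, Equiv.swap_apply_self]
  have hcov : (0 : Fin (m + 2)) ⋖ 1 := by
    refine ⟨by simp, fun z h1 h2 => ?_⟩
    simp only [Fin.lt_def, Fin.val_zero, Fin.val_one] at h1 h2
    omega
  calc (words n Φ c).card ≤ (words n Φ (c ∘ σ)).card := card_words_le_comp_perm n Φ c σ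
    _ ≤ (words n Φ (c' ∘ σ)).card := by
      refine card_words_le_of_covBy' hcov n Φ (r := r) ⟨?_, ?_, ?_⟩ ?_
      · simpa [h0] using h.1
      · simpa [h1] using h.2.1
      · intro z hz hz'
        exact h.2.2 _ (fun e => hz (σ.injective (e.trans h0.symm)))
          (fun e => hz' (σ.injective (e.trans h1.symm)))
      · simpa [h0, h1] using hr
    _ ≤ (words n Φ ((c' ∘ σ) ∘ ⇑(σ⁻¹))).card := card_words_le_comp_perm n Φ _ _
    _ = (words n Φ c').card := by
      congr 2
      ext z
      simp

/-- The total excess of the values of `c` over the threshold `t`. -/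
def excess {m : ℕ} (c : Fin m → ℕ) (t : ℕ) : ℕ := ∑ i, (c i - t)

/-- The number of values of `c` that are greater than `t`. -/
def level {m : ℕ} (c : Fin m → ℕ) (t : ℕ) : ℕ := (Finset.univ.filter (fun i => t < c i)).card

section excess

variable {m : ℕ}

theorem excess_eq_add_level (c : Fin m → ℕ) (t : ℕ) :
    excess c t = excess c (t + 1) + level c t := by
  rw [excess, excess, level, Finset.card_filter, ← Finset.sum_add_distrib]
  refine Finset.sum_congr rfl fun i _ => ?_
  split_ifs <;> omega

theorem level_eq_add_card (c : Fin m → ℕ) (t : ℕ) :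
    level c t = level c (t + 1) + (Finset.univ.filter (fun i => c i = t + 1)).card := by
  simp only [level, Finset.card_filter]
  rw [← Finset.sum_add_distrib]
  refine Finset.sum_congr rfl fun i _ => ?_
  split_ifs <;> omega

theorem level_zero_add_card (c : Fin m → ℕ) :
    level c 0 + (Finset.univ.filter (fun i => c i = 0)).card = m := by
  simp only [level, Finset.card_filter]
  rw [← Finset.sum_add_distrib]
  refine (Finset.sum_congr rfl fun i _ => ?_).trans (b := ∑ i : Fin m, 1) (by simp)
  split_ifs <;> omega

theorem excess_eventually_zero (c : Fin m → ℕ) : ∃ T, ∀ t, T ≤ t → excess c t = 0 := by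
  refine ⟨∑ i, c i, fun t ht => Finset.sum_eq_zero fun i _ => ?_⟩
  have := Finset.single_le_sum (f := c) (fun i _ => Nat.zero_le _) (Finset.mem_univ i)
  omega

theorem exists_perm_of_excess_eq {a b : Fin m → ℕ} (h : ∀ t, excess a t = excess b t) :
    ∃ σ : Equiv.Perm (Fin m), a = b ∘ σ := by
  have hl : ∀ t, level a t = level b t := fun t => by
    have h1 := excess_eq_add_level a t
    have h2 := excess_eq_add_level b t
    rw [h, h] at h1
    omega
  have hc : ∀ t, (Finset.univ.filter (fun i => a i = t)).card =
      (Finset.univ.filter (fun i => b i = t)).card := by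
    intro t
    rcases t with _ | t
    · have h1 := level_zero_add_card a
      have h2 := level_zero_add_card b
      have := hl 0
      omega
    · have h1 := level_eq_add_card a t
      have h2 := level_eq_add_card b t
      rw [hl, hl] at h1
      omega
  have e : ∀ t, Nonempty ({i // a i = t} ≃ {i // b i = t}) := fun t =>
    ⟨Fintype.equivOfCardEq (by rw [Fintype.card_subtype, Fintype.card_subtype, hc t])⟩
  exact ⟨Equiv.ofFiberEquiv fun t => (e t).some,
    funext fun i => (Equiv.ofFiberEquiv_map _ i).symm⟩

theorem Transfer.sum_add {β : Type*} [AddCommMonoid β] {i j : Fin m} (hij : i ≠ j) {r : ℕ}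
    {c c' : Fin m → ℕ} (h : Transfer i j r c c') (g : ℕ → β) :
    ∑ k, g (c k) + (g (c' i) + g (c' j)) = ∑ k, g (c' k) + (g (c i) + g (c j)) := by
  have hsplit : ∀ f : Fin m → β,
      ∑ k, f k = f i + (f j + ∑ k ∈ (Finset.univ.erase i).erase j, f k) := fun f => by
    rw [Finset.add_sum_erase _ _ (by simp [hij.symm]), Finset.add_sum_erase _ _ (by simp)]
  have hrest : ∑ k ∈ (Finset.univ.erase i).erase j, g (c' k) =
      ∑ k ∈ (Finset.univ.erase i).erase j, g (c k) := by
    refine Finset.sum_congr rfl fun k hk => ?_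
    simp only [Finset.mem_erase] at hk
    rw [h.2.2 k hk.2.1 hk.1]
  rw [hsplit (fun k => g (c k)), hsplit (fun k => g (c' k)), hrest]
  abel

/-- If `a` is strictly dominated by `b`, then a unit can be moved in `b` from a larger value to
a smaller one without losing dominance over `a`. -/
theorem exists_transfer_of_excess_lt {a b : Fin m → ℕ} (hle : ∀ t, excess a t ≤ excess b t)
    (h0 : excess a 0 = excess b 0) {t₀ : ℕ} (ht₀ : excess a t₀ < excess b t₀) :
    ∃ (i j : Fin m) (b' : Fin m → ℕ), i ≠ j ∧ b j + 2 ≤ b i ∧ Transfer i j 1 b b' ∧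
      ∀ t, excess a t ≤ excess b' t := by
  have hex : ∃ q, t₀ < q ∧ excess a q = excess b q := by
    obtain ⟨T, hT⟩ := excess_eventually_zero b
    refine ⟨T + t₀ + 1, by omega, ?_⟩
    have := hle (T + t₀ + 1)
    rw [hT _ (by omega)] at this ⊢
    omega
  obtain ⟨q, ⟨hq, hqe⟩, hqmin⟩ : ∃ q, (t₀ < q ∧ excess a q = excess b q) ∧
      ∀ s < q, ¬ (t₀ < s ∧ excess a s = excess b s) :=
    ⟨Nat.find hex, Nat.find_spec hex, fun _ => Nat.find_min hex⟩
  obtain ⟨p, hp, hpe, hpmax⟩ : ∃ p, p < t₀ ∧ excess a p = excess b p ∧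
      ∀ s, p < s → s ≤ t₀ → ¬ excess a s = excess b s := by
    have hspec := Nat.findGreatest_spec (P := fun s => excess a s = excess b s)
      (Nat.zero_le t₀) h0
    have hle' := Nat.findGreatest_le (P := fun s => excess a s = excess b s) t₀
    refine ⟨_, lt_of_le_of_ne hle' fun e => ?_, hspec, fun s hs hs' =>
      Nat.findGreatest_is_greatest (P := fun s => excess a s = excess b s) hs hs'⟩
    rw [e] at hspec
    exact ht₀.ne hspec
  have hstrict : ∀ s, p < s → s < q → excess a s < excess b s := fun s h1 h2 => by
    refine lt_of_le_of_ne (hle s) fun h => ?_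
    rcases le_or_gt s t₀ with h3 | h3
    · exact hpmax s h1 h3 h
    · exact hqmin s h2 ⟨h3, h⟩
  have ea := excess_eq_add_level a
  have eb := excess_eq_add_level b
  have la := level_eq_add_card a
  have lb := level_eq_add_card b
  have hcard : ∀ s, (¬ ∃ i, b i = s) → (Finset.univ.filter (fun i => b i = s)).card = 0 := by
    intro s hs
    rw [Finset.card_eq_zero, Finset.filter_eq_empty_iff]
    exact fun i _ h => hs ⟨i, h⟩
  obtain ⟨j, hj⟩ : ∃ j, b j = p := by
    by_contra hno
    have hz := hcard p hno
    have h1 := hstrict (p + 1) (by omega) (by omega)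
    have h2 := ea p
    have h3 := eb p
    rcases p with _ | s
    · have h4 := level_zero_add_card a
      have h5 := level_zero_add_card b
      omega
    · have := ea s
      have := eb s
      have := la s
      have := lb s
      have := hle s
      omega
  obtain ⟨i, hi⟩ : ∃ i, b i = q := by
    by_contra hno
    have hz := hcard q hno
    obtain ⟨s, rfl⟩ : ∃ s, q = s + 1 := ⟨q - 1, by omega⟩
    have := hstrict s (by omega) (by omega)
    have := ea s
    have := eb s
    have := la s
    have := lb s
    have := ea (s + 1)
    have := eb (s + 1)
    have := hle (s + 1 + 1)
    omega
  have hij : i ≠ j := by rintro rfl; omega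
  let b' : Fin m → ℕ := Function.update (Function.update b i (q - 1)) j (p + 1)
  have hi' : b' i = q - 1 := by simp [b', hij]
  have hj' : b' j = p + 1 := by simp [b']
  have hT : Transfer i j 1 b b' :=
    ⟨by omega, by omega, fun z hz hz' => by simp [b', hz, hz']⟩
  refine ⟨i, j, b', hij, by omega, hT, fun t => ?_⟩
  have hs := hT.sum_add hij (fun x => x - t)
  rw [hi', hj', hi, hj] at hs
  change excess b t + _ = excess b' t + _ at hs
  have := hle t
  by_cases ht : p < t ∧ t < q
  · have := hstrict t ht.1 ht.2
    omega
  · omega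

end excess

theorem card_words_le_of_excess_le {m : ℕ} (n : ℕ) (Φ : Finset ℕ → Prop) {a b : Fin m → ℕ}
    (hle : ∀ t, excess a t ≤ excess b t) (h0 : excess a 0 = excess b 0) :
    (words n Φ b).card ≤ (words n Φ a).card := by
  by_cases heq : ∀ t, excess a t = excess b t
  · obtain ⟨σ, rfl⟩ := exists_perm_of_excess_eq heq
    exact card_words_le_comp_perm n Φ b σ
  · push Not at heq
    obtain ⟨t₀, ht₀⟩ := heq
    obtain ⟨i, j, b', hij, hb, hT, hle'⟩ :=
      exists_transfer_of_excess_lt hle h0 (lt_of_le_of_ne (hle t₀) ht₀)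
    have hsum := hT.sum_add hij (fun x => x - 0)
    have hsq := hT.sum_add hij (fun x => x ^ 2)
    change excess b 0 + _ = excess b' 0 + _ at hsum
    have h1 := hT.1
    have h2 := hT.2.1
    have h0' : excess a 0 = excess b' 0 := by omega
    have : ∑ k, b' k ^ 2 < ∑ k, b k ^ 2 := by
      rw [h1, h2] at hsq
      rw [h1] at hb
      nlinarith
    exact (card_words_le_of_transfer n Φ hij hT (by omega)).trans
      (card_words_le_of_excess_le n Φ hle' h0')
termination_by ∑ k, b k ^ 2

theorem sum_take_le_sum_map_sub_add (l : List ℕ) (t j : ℕ) :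
    (l.take j).sum ≤ (l.map (fun x => x - t)).sum + j * t := by
  induction l generalizing j with
  | nil => simp
  | cons x l ih =>
    rcases j with _ | j
    · simp
    · have := ih j
      simp only [List.take_succ_cons, List.sum_cons, List.map_cons, Nat.succ_mul]
      omega

theorem exists_sum_take_eq_sum_map_sub_add {l : List ℕ} (hl : l.Pairwise (· ≥ ·)) (t : ℕ) :
    ∃ j, (l.take j).sum = (l.map (fun x => x - t)).sum + j * t := by
  induction l with
  | nil => exact ⟨0, by simp⟩
  | cons x l ih =>
    rw [List.pairwise_cons] at hl
    by_cases hx : t < x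
    · obtain ⟨j, hj⟩ := ih hl.2
      refine ⟨j + 1, ?_⟩
      simp only [List.take_succ_cons, List.sum_cons, List.map_cons, Nat.succ_mul]
      omega
    · refine ⟨0, ?_⟩
      simp only [List.take_zero, List.sum_nil, List.map_cons, List.sum_cons, zero_mul, add_zero]
      symm
      rw [Nat.add_eq_zero_iff]
      refine ⟨by omega, List.sum_eq_zero fun y hy => ?_⟩
      obtain ⟨z, hz, rfl⟩ := List.mem_map.1 hy
      have := hl.1 z hz
      omega

theorem Dom.sum_map_sub_le {s t : Multiset ℕ} (h : Dom s t) (u : ℕ) :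
    (s.map (fun x => x - u)).sum ≤ (t.map (fun x => x - u)).sum := by
  have hcoe : ∀ s : Multiset ℕ, ((sortDesc s : List ℕ) : Multiset ℕ) = s := fun s => by
    rw [sortDesc, Multiset.coe_reverse, Multiset.sort_eq]
  have hsum : ∀ s : Multiset ℕ, (s.map (fun x => x - u)).sum =
      ((sortDesc s).map (fun x => x - u)).sum := fun s => by
    conv_lhs => rw [← hcoe s]
    rw [Multiset.map_coe, Multiset.sum_coe]
  have hs : (sortDesc s).Pairwise (· ≥ ·) := by
    rw [sortDesc, List.pairwise_reverse]
    exact Multiset.pairwise_sort s (· ≤ ·)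
  obtain ⟨j, hj⟩ := exists_sum_take_eq_sum_map_sub_add hs u
  have h1 := h j
  have h2 := sum_take_le_sum_map_sub_add (sortDesc t) u j
  rw [hsum, hsum]
  omega

/-- The lengths of the first `m` rows of a cell set. -/
def rowLengths (s : Finset (ℕ × ℕ)) (m : ℕ) (i : Fin m) : ℕ := (rowCols s i).card

theorem mem_rowCols {s : Finset (ℕ × ℕ)} {i j : ℕ} : j ∈ rowCols s i ↔ (i, j) ∈ s := by
  simp [rowCols]

theorem rowCols_eq_empty {s : Finset (ℕ × ℕ)} {i : ℕ} (hi : i ∉ s.image Prod.fst) :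
    rowCols s i = ∅ := by
  ext j
  simp only [mem_rowCols, Finset.notMem_empty, iff_false]
  exact fun h => hi (Finset.mem_image_of_mem Prod.fst h)

theorem sum_map_rowsk_one (s : Finset (ℕ × ℕ)) (t : ℕ) :
    ((rowsk s 1).map (fun x => x - t)).sum = ∑ i ∈ s.image Prod.fst, ((rowCols s i).card - t) := by
  have h0 : ∀ M : Multiset ℕ, ((M.filter (fun m => 0 < m)).map (fun x => x - t)).sum =
      (M.map (fun x => x - t)).sum := by
    intro M
    induction M using Multiset.induction with
    | empty => simp
    | cons a M ih =>
      by_cases ha : 0 < a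
      · rw [Multiset.filter_cons_of_pos _ ha]
        simp [ih]
      · rw [Multiset.filter_cons_of_neg _ ha, ih]
        obtain rfl : a = 0 := by omega
        simp
  have h1 : ∀ i, overlapRow s 1 i = (rowCols s i).card := fun i => by
    rw [overlapRow, Finset.filter_true_of_mem]
    intro j hj t ht
    obtain rfl : t = 0 := by omega
    exact hj
  rw [rowsk, h0, Multiset.map_map]
  simp only [Function.comp_def, h1]
  rfl

theorem sum_map_rowsk_one_eq_excess {s : Finset (ℕ × ℕ)} {m : ℕ} (hm : ∀ c ∈ s, c.1 < m) (t : ℕ) :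
    ((rowsk s 1).map (fun x => x - t)).sum = excess (rowLengths s m) t := by
  rw [sum_map_rowsk_one, excess]
  simp only [rowLengths]
  rw [Fin.sum_univ_eq_sum_range (fun i => (rowCols s i).card - t) m]
  refine Finset.sum_subset (fun i hi => ?_) fun i _ hi => by simp [rowCols_eq_empty hi]
  obtain ⟨c, hc, rfl⟩ := Finset.mem_image.1 hi
  exact Finset.mem_range.2 (hm c hc)

theorem excess_rowLengths_zero {s : Finset (ℕ × ℕ)} {m : ℕ} (hm : ∀ c ∈ s, c.1 < m) :
    excess (rowLengths s m) 0 = s.card := by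
  rw [← sum_map_rowsk_one_eq_excess hm, sum_map_rowsk_one,
    Finset.card_eq_sum_card_image Prod.fst s]
  refine Finset.sum_congr rfl fun i _ => ?_
  rw [Nat.sub_zero, rowCols, Finset.card_image_of_injOn]
  intro c hc c' hc' h
  simp only [Finset.coe_filter, Set.mem_ofPred_eq] at hc hc'
  exact Prod.ext (hc.2.trans hc'.2.symm) h

theorem exists_strictMonoOn_image_eq {s t : Finset ℕ} (h : s.card = t.card) :
    ∃ f : ℕ → ℕ, StrictMonoOn f s ∧ s.image f = t := by
  let e : s ≃o t := (s.orderIsoOfFin h).symm.trans (t.orderIsoOfFin rfl)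
  refine ⟨fun j => if hj : j ∈ s then e ⟨j, hj⟩ else 0, ?_, ?_⟩
  · intro a ha b hb hab
    simp only [Finset.mem_coe] at ha hb
    simp only [ha, hb, dif_pos]
    exact e.strictMono (Subtype.mk_lt_mk.2 hab)
  · ext k
    rw [Finset.mem_image]
    constructor
    · rintro ⟨a, ha, rfl⟩
      rw [dif_pos ha]
      exact (e _).2
    · intro hk
      refine ⟨e.symm ⟨k, hk⟩, (e.symm ⟨k, hk⟩).2, ?_⟩
      rw [dif_pos (e.symm ⟨k, hk⟩).2]
      simp

namespace SYT

variable {A : SkewShape} {m : ℕ}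

theorem ext_entry {T T' : SYT A} (h : T.entry = T'.entry) : T = T' := by
  cases T; cases T'; cases h; rfl

theorem image_entry (T : SYT A) : A.cells.image T.entry = Finset.Icc 1 A.size := by
  refine Finset.eq_of_subset_of_card_le (Finset.image_subset_iff.2 T.mem_range) ?_
  rw [Finset.card_image_of_injOn T.injOn, Nat.card_Icc, SkewShape.size]
  omega

theorem exists_cell (T : SYT A) (k : Fin A.size) : ∃ c ∈ A.cells, T.entry c = k + 1 := by
  have : (k : ℕ) + 1 ∈ A.cells.image T.entry := by
    rw [image_entry, Finset.mem_Icc]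
    omega
  simpa using this

/-- The cell containing the entry `k + 1`. -/
noncomputable def cellAt (T : SYT A) (k : Fin A.size) : ℕ × ℕ := (T.exists_cell k).choose

theorem cellAt_mem (T : SYT A) (k : Fin A.size) : T.cellAt k ∈ A.cells :=
  (T.exists_cell k).choose_spec.1

theorem entry_cellAt (T : SYT A) (k : Fin A.size) : T.entry (T.cellAt k) = k + 1 :=
  (T.exists_cell k).choose_spec.2

theorem cellAt_eq (T : SYT A) {k : Fin A.size} {c : ℕ × ℕ} (hc : c ∈ A.cells)
    (h : T.entry c = k + 1) : T.cellAt k = c :=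
  T.injOn (T.cellAt_mem k) hc ((T.entry_cellAt k).trans h.symm)

theorem exists_cellAt_eq (T : SYT A) {c : ℕ × ℕ} (hc : c ∈ A.cells) :
    ∃ k : Fin A.size, T.entry c = k + 1 ∧ T.cellAt k = c := by
  have h := Finset.mem_Icc.1 (T.mem_range c hc)
  have hval : T.entry c = T.entry c - 1 + 1 := by omega
  exact ⟨⟨T.entry c - 1, by omega⟩, hval, T.cellAt_eq hc hval⟩

/-- The reading word of a tableau: the `k`-th letter is the row of the `k`-th entry. -/
noncomputable def word (hm : ∀ c ∈ A.cells, c.1 < m) (T : SYT A) (k : Fin A.size) : Fin m :=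
  ⟨(T.cellAt k).1, hm _ (T.cellAt_mem k)⟩

theorem ascents_word (hm : ∀ c ∈ A.cells, c.1 < m) (T : SYT A) :
    ascents (T.word hm) = T.descentSet := by
  refine Finset.filter_congr fun k hk => ?_
  constructor
  · rintro ⟨i, j, hi, hj, hlt⟩
    exact ⟨T.cellAt i, T.cellAt_mem i, T.cellAt j, T.cellAt_mem j,
      (T.entry_cellAt i).trans hi, (T.entry_cellAt j).trans (by rw [hj]), hlt⟩
  · rintro ⟨c, hc, c', hc', h, h', hlt⟩
    obtain ⟨i, hi, rfl⟩ := T.exists_cellAt_eq hc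
    obtain ⟨j, hj, rfl⟩ := T.exists_cellAt_eq hc'
    exact ⟨i, j, by omega, by omega, hlt⟩

theorem card_word_eq (hm : ∀ c ∈ A.cells, c.1 < m) (T : SYT A) (a : Fin m) :
    (Finset.univ.filter (fun k => T.word hm k = a)).card = rowLengths A.cells m a := by
  refine Finset.card_bij (fun k _ => (T.cellAt k).2) ?_ ?_ ?_
  · intro k hk
    simp only [Finset.mem_filter, Finset.mem_univ, true_and, word, Fin.ext_iff] at hk
    rw [mem_rowCols, ← hk]
    exact T.cellAt_mem k
  · intro k hk l hl h
    simp only [Finset.mem_filter, Finset.mem_univ, true_and, word, Fin.ext_iff] at hk hl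
    have hc : T.cellAt k = T.cellAt l := Prod.ext (hk.trans hl.symm) h
    have := T.entry_cellAt k
    rw [hc, T.entry_cellAt] at this
    exact Fin.ext (by omega)
  · intro j hj
    rw [mem_rowCols] at hj
    obtain ⟨k, -, hk⟩ := T.exists_cellAt_eq hj
    refine ⟨k, ?_, by rw [hk]⟩
    simp [word, Fin.ext_iff, hk]

theorem word_injective (hm : ∀ c ∈ A.cells, c.1 < m) :
    Function.Injective (word hm : SYT A → Fin A.size → Fin m) := by
  intro T T' h
  have hrow : ∀ k, (T.cellAt k).1 = (T'.cellAt k).1 := fun k =>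
    congrArg Fin.val (congrFun h k)
  refine ext_entry (funext fun ⟨i, j⟩ => ?_)
  by_cases hc : (i, j) ∈ A.cells
  swap
  · rw [T.zero_off _ hc, T'.zero_off _ hc]
  let g : SYT A → {j // (i, j) ∈ A.cells} → ℕ := fun T j => T.entry (i, j)
  have hmono : ∀ T, StrictMono (g T) := fun T a b hab => T.row_lt i a b a.2 b.2 hab
  have hsub : ∀ T T' : SYT A, (∀ k, (T.cellAt k).1 = (T'.cellAt k).1) →
      Set.range (g T) ⊆ Set.range (g T') := by
    rintro T T' hrow _ ⟨j, rfl⟩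
    obtain ⟨k, hk, hk'⟩ := T.exists_cellAt_eq j.2
    have hi : (T'.cellAt k).1 = i := by rw [← hrow, hk']
    have hmem := T'.cellAt_mem k
    have he := T'.entry_cellAt k
    rw [← Prod.mk.eta (p := T'.cellAt k), hi] at hmem he
    exact ⟨⟨_, hmem⟩, he.trans hk.symm⟩
  have := ((hmono T).range_inj (hmono T')).1
    ((hsub T T' hrow).antisymm (hsub T' T fun k => (hrow k).symm))
  exact congrFun this ⟨j, hc⟩

theorem exists_word_eq (hA : IsHorizontalStrip A) (hm : ∀ c ∈ A.cells, c.1 < m)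
    {w : Fin A.size → Fin m}
    (hw : ∀ a, (Finset.univ.filter (fun k => w k = a)).card = rowLengths A.cells m a) :
    ∃ T : SYT A, T.word hm = w := by
  have hinj : Function.Injective (fun k : Fin A.size => (k : ℕ) + 1) := fun a b h =>
    Fin.ext (Nat.succ_injective h)
  have hrow : ∀ i : ℕ, ∃ f : ℕ → ℕ, StrictMonoOn f (rowCols A.cells i) ∧
      (rowCols A.cells i).image f =
        (Finset.univ.filter (fun k => (w k : ℕ) = i)).image (fun k : Fin A.size => (k : ℕ) + 1) := by
    intro i
    refine exists_strictMonoOn_image_eq ?_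
    rw [Finset.card_image_of_injective _ hinj]
    by_cases hi : i < m
    · simpa [Fin.ext_iff, rowLengths] using (hw ⟨i, hi⟩).symm
    · rw [rowCols_eq_empty, Finset.filter_false_of_mem]
      · rfl
      · intro k _ h
        omega
      · intro h
        obtain ⟨c, hc, rfl⟩ := Finset.mem_image.1 h
        exact hi (hm c hc)
  choose f hmono himage using hrow
  have hentry : ∀ i j, (i, j) ∈ A.cells →
      ∃ k : Fin A.size, (w k : ℕ) = i ∧ f i j = k + 1 := by
    intro i j hij
    have := Finset.mem_image_of_mem (f i) (mem_rowCols.2 hij)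
    rw [himage] at this
    obtain ⟨k, hk, hk'⟩ := Finset.mem_image.1 this
    exact ⟨k, (Finset.mem_filter.1 hk).2, hk'.symm⟩
  let T : SYT A :=
    { entry := fun c => if c ∈ A.cells then f c.1 c.2 else 0
      zero_off := fun c hc => if_neg hc
      mem_range := by
        rintro ⟨i, j⟩ hc
        obtain ⟨k, -, hk⟩ := hentry i j hc
        rw [if_pos hc, Finset.mem_Icc, hk]
        omega
      injOn := by
        rintro ⟨i, j⟩ hc ⟨i', j'⟩ hc' h
        rw [Finset.mem_coe] at hc hc'
        simp only [hc, hc', if_true] at h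
        obtain ⟨k, hk, hk'⟩ := hentry i j hc
        obtain ⟨l, hl, hl'⟩ := hentry i' j' hc'
        obtain rfl : k = l := Fin.ext (by omega)
        obtain rfl : i = i' := hk.symm.trans hl
        rw [(hmono i).injOn (mem_rowCols.2 hc) (mem_rowCols.2 hc') h]
      row_lt := by
        intro i j j' hc hc' h
        rw [if_pos hc, if_pos hc']
        exact hmono i (mem_rowCols.2 hc) (mem_rowCols.2 hc') h
      col_lt := by
        intro i i' j hc hc' h
        have hmem : ∀ a, (a, j) ∈ A.cells → a ∈ colRows A.cells j := fun a ha => by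
          simpa [colRows] using ha
        exact absurd (Finset.card_le_one.1 (hA j) i (hmem i hc) i' (hmem i' hc')) h.ne }
  refine ⟨T, funext fun k => ?_⟩
  have hc := T.cellAt_mem k
  obtain ⟨l, hl, hl'⟩ := hentry (T.cellAt k).1 (T.cellAt k).2 hc
  have he : T.entry (T.cellAt k) = f (T.cellAt k).1 (T.cellAt k).2 := if_pos hc
  rw [T.entry_cellAt, hl'] at he
  obtain rfl : k = l := Fin.ext (by omega)
  exact Fin.ext hl.symm

end SYT

theorem countSYT_eq_card_words {A : SkewShape} (hA : IsHorizontalStrip A) {m : ℕ}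
    (hm : ∀ c ∈ A.cells, c.1 < m) (α : List ℕ) :
    countSYT A α =
      (words A.size (fun D => compOfSet A.size D = α) (rowLengths A.cells m)).card := by
  rw [countSYT, ← Fintype.card_coe, ← Nat.card_eq_fintype_card]
  refine Nat.card_eq_of_bijective (fun T => ⟨T.1.word hm, ?_⟩) ⟨?_, ?_⟩
  · rw [mem_words]
    refine ⟨fun a => T.1.card_word_eq hm a, ?_⟩
    · rw [SYT.ascents_word]
      exact T.2
  · intro T T' h
    exact Subtype.ext (SYT.word_injective hm (congrArg Subtype.val h))
  · rintro ⟨w, hw⟩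
    rw [mem_words] at hw
    obtain ⟨hcont, hΦ⟩ := hw
    obtain ⟨T, rfl⟩ := SYT.exists_word_eq hA hm hcont
    rw [SYT.ascents_word] at hΦ
    exact ⟨⟨T, hΦ⟩, rfl⟩

instance SYT.finite (A : SkewShape) : Finite (SYT A) := by
  have hm : ∀ c ∈ A.cells, c.1 < A.cells.sup Prod.fst + 1 := fun c hc =>
    Nat.lt_succ_of_le (Finset.le_sup (f := Prod.fst) hc)
  exact Finite.of_injective _ (SYT.word_injective hm)

theorem stmt14 (A B : SkewShape)
    (hA : IsHorizontalStrip A) (hB : IsHorizontalStrip B) (hsize : A.size = B.size)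
    (hdom : Dom (rowsk A.cells 1) (rowsk B.cells 1)) :
    (∀ α : List ℕ, countSYT B α ≤ countSYT A α) ∧ Fsupp B ⊆ Fsupp A := by
  have hcount : ∀ α : List ℕ, countSYT B α ≤ countSYT A α := by
    intro α
    let m := (A.cells ∪ B.cells).sup Prod.fst + 1
    have hmA : ∀ c ∈ A.cells, c.1 < m := fun c hc =>
      Nat.lt_succ_of_le (Finset.le_sup (f := Prod.fst) (Finset.mem_union_left _ hc))
    have hmB : ∀ c ∈ B.cells, c.1 < m := fun c hc =>
      Nat.lt_succ_of_le (Finset.le_sup (f := Prod.fst) (Finset.mem_union_right _ hc))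
    rw [countSYT_eq_card_words hA hmA, countSYT_eq_card_words hB hmB, hsize]
    refine card_words_le_of_excess_le _ _ (fun t => ?_) ?_
    · rw [← sum_map_rowsk_one_eq_excess hmA, ← sum_map_rowsk_one_eq_excess hmB]
      exact hdom.sum_map_sub_le t
    · rw [excess_rowLengths_zero hmA, excess_rowLengths_zero hmB]
      exact hsize
  refine ⟨hcount, ?_⟩
  rintro α ⟨T, hT⟩
  have hpos : 0 < countSYT B α := Nat.card_pos_iff.2 ⟨⟨⟨T, hT⟩⟩, inferInstance⟩
  obtain ⟨⟨T', hT'⟩⟩ := (Nat.card_pos_iff.1 (hpos.trans_le (hcount α))).1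
  exact ⟨T', hT'⟩

end SkewPaper
end

section
/- Let n ≥ 4. Let A be the skew shape (n−1, 1, 1)/(1), i.e., the disconnected shape (1^2) ⊕ (n−2), and let B be the straight shape (n−2, 2). Then s_A − s_B is F-positive: for every composition α of n, the number of standard Young tableaux of shape B with descent composition α is at most the number of standard Young tableaux of shape A with descent composition α. -/
namespace SkewPaper

open Finset

theorem SYT.ext_entry_s17 {A : SkewShape} {T T' : SYT A} (h : T.entry = T'.entry) : T = T' := by
  cases T; cases T'; cases h; rfl

instance SYT.instFinite (A : SkewShape) : Finite (SYT A) := by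
  let f : SYT A → (A.cells → Fin (A.size + 1)) := fun T c =>
    ⟨T.entry c, by have := Finset.mem_Icc.1 (T.mem_range c c.2); omega⟩
  refine Finite.of_injective f fun T T' h => SYT.ext_entry_s17 (funext fun c => ?_)
  by_cases hc : c ∈ A.cells
  · simpa [f] using congrFun h ⟨c, hc⟩
  · rw [T.zero_off c hc, T'.zero_off c hc]

theorem SYT.image_entry_s17 {A : SkewShape} (T : SYT A) :
    A.cells.image T.entry = Finset.Icc 1 A.size := by
  refine Finset.eq_of_subset_of_card_le (Finset.image_subset_iff.2 T.mem_range) ?_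
  rw [Finset.card_image_of_injOn T.injOn]
  simp [SkewShape.size]

theorem SYT.exists_entry_eq {A : SkewShape} (T : SYT A) {k : ℕ} (h1 : 1 ≤ k) (h2 : k ≤ A.size) :
    ∃ c ∈ A.cells, T.entry c = k := by
  have : k ∈ A.cells.image T.entry := by
    rw [T.image_entry_s17]; exact Finset.mem_Icc.2 ⟨h1, h2⟩
  simpa using this

/-- The cells of the disconnected shape `(1^2) ⊕ (n-2)`. -/
def columnRowCells (n : ℕ) : Finset (ℕ × ℕ) :=
  ((Finset.Icc 1 (n - 2)).image (fun j => ((0 : ℕ), j))) ∪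
    ({((1 : ℕ), (0 : ℕ)), ((2 : ℕ), (0 : ℕ))} : Finset (ℕ × ℕ))

/-- The cells of the straight shape `(n-2, 2)`. -/
def twoRowCells (n : ℕ) : Finset (ℕ × ℕ) :=
  ((Finset.range (n - 2)).image (fun j => ((0 : ℕ), j))) ∪
    ((Finset.range 2).image (fun j => ((1 : ℕ), j)))

theorem mem_columnRowCells {n i j : ℕ} : (i, j) ∈ columnRowCells n ↔
    (i = 0 ∧ 1 ≤ j ∧ j ≤ n - 2) ∨ (i = 1 ∧ j = 0) ∨ (i = 2 ∧ j = 0) := by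
  simp only [columnRowCells, mem_union, mem_image, mem_Icc, mem_insert, mem_singleton,
    Prod.mk.injEq]
  grind

theorem mem_twoRowCells {n i j : ℕ} : (i, j) ∈ twoRowCells n ↔
    (i = 0 ∧ j < n - 2) ∨ (i = 1 ∧ j < 2) := by
  simp only [twoRowCells, mem_union, mem_image, Finset.mem_range, Prod.mk.injEq]
  grind

theorem card_columnRowCells {n : ℕ} (hn : 2 ≤ n) : (columnRowCells n).card = n := by
  rw [columnRowCells, Finset.card_union_of_disjoint, Finset.card_image_of_injective]
  · simp; omega
  · exact Prod.mk_right_injective 0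
  · rw [Finset.disjoint_left]
    rintro ⟨i, j⟩ h
    simp only [mem_image, mem_insert, mem_singleton, Prod.mk.injEq] at h ⊢
    grind

theorem card_twoRowCells {n : ℕ} (hn : 2 ≤ n) : (twoRowCells n).card = n := by
  rw [twoRowCells, Finset.card_union_of_disjoint, Finset.card_image_of_injective,
    Finset.card_image_of_injective]
  · simp; omega
  · exact Prod.mk_right_injective 1
  · exact Prod.mk_right_injective 0
  · rw [Finset.disjoint_left]
    rintro ⟨i, j⟩ h
    simp only [mem_image, Prod.mk.injEq] at h ⊢
    grind

section ColumnRow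

/-- The filling of `(1^2) ⊕ (n-2)` with column entries `a < b` and the remaining numbers
increasing along the row. -/
def columnRowEntry (n a b : ℕ) (c : ℕ × ℕ) : ℕ :=
  if c.1 = 0 ∧ 1 ≤ c.2 ∧ c.2 ≤ n - 2 then
    if c.2 < a then c.2 else if c.2 + 1 < b then c.2 + 1 else c.2 + 2
  else if c.1 = 1 ∧ c.2 = 0 then a
  else if c.1 = 2 ∧ c.2 = 0 then b
  else 0

/-- The standard Young tableau of shape `(1^2) ⊕ (n-2)` with column entries `a < b`. -/
def columnRowSYT {n : ℕ} {A : SkewShape} (hA : A.cells = columnRowCells n) (hn : 2 ≤ n)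
    {a b : ℕ} (ha : 1 ≤ a) (hab : a < b) (hb : b ≤ n) : SYT A where
  entry := columnRowEntry n a b
  zero_off := by
    rintro ⟨i, j⟩ h
    rw [hA, mem_columnRowCells] at h
    grind [columnRowEntry]
  mem_range := by
    rintro ⟨i, j⟩ h
    rw [hA, mem_columnRowCells] at h
    rw [SkewShape.size, hA, card_columnRowCells hn, Finset.mem_Icc]
    grind [columnRowEntry]
  injOn := by
    rintro ⟨i, j⟩ h ⟨i', j'⟩ h' heq
    rw [Finset.mem_coe, hA, mem_columnRowCells] at h h'
    rw [Prod.mk.injEq]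
    rcases h with h | h | h <;> rcases h' with h' | h' | h' <;>
      simp only [columnRowEntry, h, h'] at heq <;> grind
  row_lt := by
    intro i j j' h h' hj
    rw [hA, mem_columnRowCells] at h h'
    grind [columnRowEntry]
  col_lt := by
    intro i i' j h h' hi
    rw [hA, mem_columnRowCells] at h h'
    grind [columnRowEntry]

variable {n : ℕ} {A : SkewShape}

theorem mem_descentSet_columnRow (hA : A.cells = columnRowCells n) (hn : 2 ≤ n)
    (T : SYT A) (k : ℕ) :
    k ∈ T.descentSet ↔ 1 ≤ k ∧ (k + 1 = T.entry (1, 0) ∨ k + 1 = T.entry (2, 0)) := by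
  have hsize : A.size = n := by rw [SkewShape.size, hA, card_columnRowCells hn]
  have h1 : ((1 : ℕ), (0 : ℕ)) ∈ A.cells := by rw [hA, mem_columnRowCells]; simp
  have h2 : ((2 : ℕ), (0 : ℕ)) ∈ A.cells := by rw [hA, mem_columnRowCells]; simp
  have hlt : T.entry (1, 0) < T.entry (2, 0) := T.col_lt 1 2 0 h1 h2 one_lt_two
  have hr1 := Finset.mem_Icc.1 (T.mem_range _ h1)
  have hr2 := Finset.mem_Icc.1 (T.mem_range _ h2)
  rw [SYT.descentSet, Finset.mem_filter, Finset.mem_Ico]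
  constructor
  · rintro ⟨hk, ⟨i, j⟩, hc, ⟨i', j'⟩, hc', e, e', hlt'⟩
    rw [hA, mem_columnRowCells] at hc hc'
    grind
  · rintro ⟨hk, h⟩
    have hkn : k < A.size := by omega
    obtain ⟨⟨i, j⟩, hc, e⟩ := T.exists_entry_eq hk hkn.le
    have hc0 := hc
    rw [hA, mem_columnRowCells] at hc
    refine ⟨⟨hk, hkn⟩, (i, j), hc0, ?_⟩
    rcases h with h | h
    · exact ⟨_, h1, e, h.symm, by grind⟩
    · exact ⟨_, h2, e, h.symm, by grind⟩

end ColumnRow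

section TwoRow

variable {n : ℕ} {B : SkewShape}

theorem mem_descentSet_twoRow (hB : B.cells = twoRowCells n) (hn : 2 ≤ n)
    (T : SYT B) (k : ℕ) :
    k ∈ T.descentSet ↔ 1 ≤ k ∧ k ≠ T.entry (1, 0) ∧
      (k + 1 = T.entry (1, 0) ∨ k + 1 = T.entry (1, 1)) := by
  have hsize : B.size = n := by rw [SkewShape.size, hB, card_twoRowCells hn]
  have h0 : ((1 : ℕ), (0 : ℕ)) ∈ B.cells := by rw [hB, mem_twoRowCells]; simp
  have h1 : ((1 : ℕ), (1 : ℕ)) ∈ B.cells := by rw [hB, mem_twoRowCells]; simp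
  have hlt : T.entry (1, 0) < T.entry (1, 1) := T.row_lt 1 0 1 h0 h1 one_pos
  have hr0 := Finset.mem_Icc.1 (T.mem_range _ h0)
  have hr1 := Finset.mem_Icc.1 (T.mem_range _ h1)
  have key : ∀ j, j < 2 → j = 0 ∨ j = 1 := by omega
  rw [SYT.descentSet, Finset.mem_filter, Finset.mem_Ico]
  constructor
  · rintro ⟨hk, ⟨i, j⟩, hc, ⟨i', j'⟩, hc', e, e', hlt'⟩
    have hc0 := hc
    rw [hB, mem_twoRowCells] at hc hc'
    have hi : i = 0 := by grind
    have hi' : i' = 1 := by grind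
    refine ⟨hk.1, fun h => ?_, by grind⟩
    have := T.injOn hc0 h0 (e.trans h)
    grind
  · rintro ⟨hk, hne, h⟩
    have hkn : k < B.size := by omega
    obtain ⟨⟨i, j⟩, hc, e⟩ := T.exists_entry_eq hk hkn.le
    have hc0 := hc
    rw [hB, mem_twoRowCells] at hc
    have hi : i = 0 := by
      rcases hc with hc | ⟨rfl, hj⟩
      · exact hc.1
      · rcases key j hj with rfl | rfl <;> omega
    refine ⟨⟨hk, hkn⟩, (i, j), hc0, ?_⟩
    rcases h with h | h
    · exact ⟨_, h0, e, h.symm, by grind⟩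
    · exact ⟨_, h1, e, h.symm, by grind⟩

theorem twoRow_entry_bounds (hB : B.cells = twoRowCells n) (hn : 3 ≤ n) (T : SYT B) :
    2 ≤ T.entry (1, 0) ∧ T.entry (1, 0) < T.entry (1, 1) ∧ T.entry (1, 1) ≤ n := by
  have h00 : ((0 : ℕ), (0 : ℕ)) ∈ B.cells := by rw [hB, mem_twoRowCells]; omega
  have h0 : ((1 : ℕ), (0 : ℕ)) ∈ B.cells := by rw [hB, mem_twoRowCells]; simp
  have h1 : ((1 : ℕ), (1 : ℕ)) ∈ B.cells := by rw [hB, mem_twoRowCells]; simp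
  have hlt := T.row_lt 1 0 1 h0 h1 one_pos
  have hlt' := T.col_lt 0 1 0 h00 h0 one_pos
  have hr := Finset.mem_Icc.1 (T.mem_range _ h00)
  have hr1 := Finset.mem_Icc.1 (T.mem_range _ h1)
  rw [SkewShape.size, hB, card_twoRowCells (by omega)] at hr1
  omega

/-- The entries of the first row are those not in the second row. -/
theorem image_firstRow_twoRow (hB : B.cells = twoRowCells n) (T : SYT B) :
    (Finset.range (n - 2)).image (fun j => T.entry (0, j)) =
      Finset.Icc 1 B.size \ {T.entry (1, 0), T.entry (1, 1)} := by
  have h0 : ((1 : ℕ), (0 : ℕ)) ∈ B.cells := by rw [hB, mem_twoRowCells]; simp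
  have h1 : ((1 : ℕ), (1 : ℕ)) ∈ B.cells := by rw [hB, mem_twoRowCells]; simp
  ext k
  simp only [mem_image, Finset.mem_range, mem_sdiff, mem_insert, mem_singleton]
  constructor
  · rintro ⟨j, hj, rfl⟩
    have hc : (0, j) ∈ B.cells := by rw [hB, mem_twoRowCells]; exact Or.inl ⟨rfl, hj⟩
    refine ⟨T.mem_range _ hc, ?_⟩
    rintro (h | h)
    · exact absurd (T.injOn hc h0 h) (by simp)
    · exact absurd (T.injOn hc h1 h) (by simp)
  · rintro ⟨hk, hne⟩
    rw [Finset.mem_Icc] at hk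
    obtain ⟨⟨i, j⟩, hc, e⟩ := T.exists_entry_eq hk.1 hk.2
    rw [hB, mem_twoRowCells] at hc
    rcases hc with ⟨rfl, hj⟩ | ⟨rfl, hj⟩
    · exact ⟨j, hj, e⟩
    · have : j = 0 ∨ j = 1 := by omega
      rcases this with rfl | rfl <;> simp [e] at hne

/-- A standard Young tableau of shape `(n-2, 2)` is determined by its second row. -/
theorem twoRow_ext (hB : B.cells = twoRowCells n) {T T' : SYT B}
    (h0 : T.entry (1, 0) = T'.entry (1, 0)) (h1 : T.entry (1, 1) = T'.entry (1, 1)) :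
    T = T' := by
  have hmono (T : SYT B) : StrictMono (fun j : Fin (n - 2) => T.entry (0, j)) := by
    intro j j' hj
    refine T.row_lt 0 j j' ?_ ?_ hj <;> rw [hB, mem_twoRowCells] <;> simp
  have hrange (T : SYT B) : Set.range (fun j : Fin (n - 2) => T.entry (0, j)) =
      ↑((Finset.range (n - 2)).image (fun j => T.entry (0, j))) := by
    ext k
    simp only [Set.mem_range, coe_image, Set.mem_image, Finset.mem_coe, Finset.mem_range]
    exact ⟨fun ⟨j, hj⟩ => ⟨j, j.2, hj⟩, fun ⟨j, hj, e⟩ => ⟨⟨j, hj⟩, e⟩⟩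
  have hrow : (fun j : Fin (n - 2) => T.entry (0, j)) =
      fun j : Fin (n - 2) => T'.entry (0, j) := by
    refine ((hmono T).range_inj (hmono T')).1 ?_
    rw [hrange, hrange, image_firstRow_twoRow hB, image_firstRow_twoRow hB, h0, h1]
  refine SYT.ext_entry_s17 (funext fun ⟨i, j⟩ => ?_)
  by_cases hc : (i, j) ∈ B.cells
  · rw [hB, mem_twoRowCells] at hc
    rcases hc with ⟨rfl, hj⟩ | ⟨rfl, hj⟩
    · exact congrFun hrow ⟨j, hj⟩
    · have : j = 0 ∨ j = 1 := by omega
      rcases this with rfl | rfl <;> assumption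
  · rw [T.zero_off _ hc, T'.zero_off _ hc]

end TwoRow

/-- A tableau of shape `(n-2, 2)` with second row `a, b` is sent to the tableau of shape
`(1^2) ⊕ (n-2)` with column entries `1, a` if `b = a + 1`, and `a, b` otherwise. -/
theorem exists_columnRow_of_twoRow {n : ℕ} (hn : 3 ≤ n) {A B : SkewShape}
    (hA : A.cells = columnRowCells n) (hB : B.cells = twoRowCells n) (T : SYT B) :
    ∃ T' : SYT A, T'.descentComp = T.descentComp ∧
      T'.entry (1, 0) = (if T.entry (1, 1) = T.entry (1, 0) + 1 then 1 else T.entry (1, 0)) ∧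
      T'.entry (2, 0) =
        (if T.entry (1, 1) = T.entry (1, 0) + 1 then T.entry (1, 0) else T.entry (1, 1)) := by
  obtain ⟨h2, hlt, hle⟩ := twoRow_entry_bounds hB hn T
  have hsize : A.size = B.size := by
    rw [SkewShape.size, SkewShape.size, hA, hB, card_columnRowCells (by omega),
      card_twoRowCells (by omega)]
  have hn2 : 2 ≤ n := by omega
  obtain ⟨T', e1, e2⟩ : ∃ T' : SYT A,
      T'.entry (1, 0) = (if T.entry (1, 1) = T.entry (1, 0) + 1 then 1 else T.entry (1, 0)) ∧
      T'.entry (2, 0) =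
        (if T.entry (1, 1) = T.entry (1, 0) + 1 then T.entry (1, 0) else T.entry (1, 1)) :=
    ⟨columnRowSYT hA hn2
      (a := if T.entry (1, 1) = T.entry (1, 0) + 1 then 1 else T.entry (1, 0))
      (b := if T.entry (1, 1) = T.entry (1, 0) + 1 then T.entry (1, 0) else T.entry (1, 1))
      (by split_ifs <;> omega) (by split_ifs <;> omega)
      (by split_ifs <;> omega), by simp [columnRowSYT, columnRowEntry],
      by simp [columnRowSYT, columnRowEntry]⟩
  refine ⟨T', ?_, e1, e2⟩
  have hdesc : T'.descentSet = T.descentSet := by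
    ext k
    rw [mem_descentSet_columnRow hA hn2, mem_descentSet_twoRow hB hn2, e1, e2]
    split_ifs <;> omega
  rw [SYT.descentComp, SYT.descentComp, hdesc, hsize]

theorem stmt17 (n : ℕ) (hn : 4 ≤ n) (A B : SkewShape)
    (hA : A.cells = ((Finset.Icc 1 (n - 2)).image (fun j => ((0 : ℕ), j))) ∪
      ({((1 : ℕ), (0 : ℕ)), ((2 : ℕ), (0 : ℕ))} : Finset (ℕ × ℕ)))
    (hB : B.cells = ((Finset.range (n - 2)).image (fun j => ((0 : ℕ), j))) ∪
      ((Finset.range 2).image (fun j => ((1 : ℕ), j)))) :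
    ∀ α : List ℕ, countSYT B α ≤ countSYT A α := by
  intro α
  have hn3 : 3 ≤ n := by omega
  choose f hf h1 h2 using exists_columnRow_of_twoRow (A := A) (B := B) hn3 hA hB
  refine Nat.card_le_card_of_injective
    (fun T : {T : SYT B // T.descentComp = α} =>
      (⟨f T.1, (hf T.1).trans T.2⟩ : {T : SYT A // T.descentComp = α})) ?_
  rintro ⟨T, hT⟩ ⟨T', hT'⟩ heq
  have hfeq : f T = f T' := congrArg Subtype.val heq
  have e1 := h1 T
  have e2 := h2 T
  rw [hfeq, h1 T'] at e1
  rw [hfeq, h2 T'] at e2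
  obtain ⟨b1, b2, -⟩ := twoRow_entry_bounds hB hn3 T
  obtain ⟨b1', b2', -⟩ := twoRow_entry_bounds hB hn3 T'
  refine Subtype.ext (twoRow_ext hB ?_ ?_) <;> dsimp only <;> split_ifs at e1 e2 <;> omega

end SkewPaper
end
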